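/- Let Y = X̃γ̃ + ε, where X̃ is an n×p real matrix with unit ℓ²-norm columns, γ̃ ∈ ℝᵖ is S-sparse, and δ_{2S}^{X̃} + θ_{S,2S}^{X̃} < 1. Suppose λ ≥ 0 satisfies ‖X̃ᵀε‖_∞ ≤ λ, and let γ̂ be any Dantzig selector solution for (Y, X̃, λ). Then ‖γ̂ − γ̃‖₂ ≤ 4λ√S / (1 − δ_{2S}^{X̃} − θ_{S,2S}^{X̃}). -/

import Mathlib

open scoped BigOperators
open Matrix

noncomputable section

/-- A vector is `S`-sparse if it has at most `S` nonzero components. -/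
def SSparse {p : ℕ} (S : ℕ) (c : Fin p → ℝ) : Prop :=
  (Finset.univ.filter fun j => c j ≠ 0).card ≤ S

/-- Euclidean (ℓ²) norm of a finite vector. -/
def l2norm {k : ℕ} (c : Fin k → ℝ) : ℝ := Real.sqrt (∑ j, (c j) ^ 2)

/-- The restricted isometry constant `δ_S` of a matrix (with unit-norm columns): the smallest
`δ ≥ 0` such that `(1-δ)‖c‖₂² ≤ ‖Xc‖₂² ≤ (1+δ)‖c‖₂²` for every `S`-sparse vector `c`. -/
def ripDelta {n p : ℕ} (X : Matrix (Fin n) (Fin p) ℝ) (S : ℕ) : ℝ :=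
  sInf {δ : ℝ | 0 ≤ δ ∧ ∀ c : Fin p → ℝ, SSparse S c →
    (1 - δ) * ∑ j, (c j) ^ 2 ≤ ∑ i, (X.mulVec c i) ^ 2 ∧
      ∑ i, (X.mulVec c i) ^ 2 ≤ (1 + δ) * ∑ j, (c j) ^ 2}

/-- The restricted orthogonality constant `θ_{S,S'}` of a matrix: the smallest `θ ≥ 0` such that
`|⟨Xc, Xc'⟩| ≤ θ‖c‖₂‖c'‖₂` for all `S`-sparse `c` and `S'`-sparse `c'` with disjoint supports. -/
def ripTheta {n p : ℕ} (X : Matrix (Fin n) (Fin p) ℝ) (S S' : ℕ) : ℝ :=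
  sInf {θ : ℝ | 0 ≤ θ ∧ ∀ c c' : Fin p → ℝ, SSparse S c → SSparse S' c' →
    (∀ j, c j = 0 ∨ c' j = 0) →
    |∑ i, X.mulVec c i * X.mulVec c' i| ≤ θ * l2norm c * l2norm c'}

/-- `b` is a Dantzig selector solution for `(Y, W, λ)`: it minimizes the ℓ¹ norm over the
feasible set `{β : ‖Wᵀ(Y - Wβ)‖_∞ ≤ λ}`. -/
def IsDantzigSol {n p : ℕ} (Y : Fin n → ℝ) (W : Matrix (Fin n) (Fin p) ℝ)
    (lam : ℝ) (b : Fin p → ℝ) : Prop :=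
  (∀ j, |∑ i, W i j * (Y i - W.mulVec b i)| ≤ lam) ∧
    ∀ b' : Fin p → ℝ, (∀ j, |∑ i, W i j * (Y i - W.mulVec b' i)| ≤ lam) →
      ∑ j, |b j| ≤ ∑ j, |b' j|

/-- The ℓ² norm of the `j`-th column of a matrix. -/
def colNorm {n p : ℕ} (V : Matrix (Fin n) (Fin p) ℝ) (j : Fin p) : ℝ :=
  Real.sqrt (∑ i, (V i j) ^ 2)

theorem l2norm_nonneg {k : ℕ} (c : Fin k → ℝ) : 0 ≤ l2norm c := Real.sqrt_nonneg _

theorem l2norm_sq {k : ℕ} (c : Fin k → ℝ) : l2norm c ^ 2 = ∑ j, c j ^ 2 :=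
  Real.sq_sqrt (Finset.sum_nonneg fun _ _ => sq_nonneg _)

/-- The squared Frobenius norm bounds the squared operator norm. -/
theorem sum_mulVec_sq_le {n p : ℕ} (X : Matrix (Fin n) (Fin p) ℝ) (c : Fin p → ℝ) :
    ∑ i, X.mulVec c i ^ 2 ≤ (∑ i, ∑ j, X i j ^ 2) * ∑ j, c j ^ 2 := by
  rw [Finset.sum_mul]
  exact Finset.sum_le_sum fun i _ => Finset.sum_mul_sq_le_sq_mul_sq Finset.univ (X i) c

theorem ripDelta_lower {n p : ℕ} (X : Matrix (Fin n) (Fin p) ℝ) (S : ℕ) {c : Fin p → ℝ}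
    (hc : SSparse S c) :
    (1 - ripDelta X S) * ∑ j, c j ^ 2 ≤ ∑ i, X.mulVec c i ^ 2 := by
  have hF : 0 ≤ ∑ i, ∑ j, X i j ^ 2 :=
    Finset.sum_nonneg fun _ _ => Finset.sum_nonneg fun _ _ => sq_nonneg _
  rcases (Finset.sum_nonneg fun j _ => sq_nonneg (c j) :
    0 ≤ ∑ j, c j ^ 2).eq_or_lt with h0 | hpos
  · rw [← h0, mul_zero]
    exact Finset.sum_nonneg fun _ _ => sq_nonneg _
  have key : 1 - (∑ i, X.mulVec c i ^ 2) / ∑ j, c j ^ 2 ≤ ripDelta X S := by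
    refine le_csInf ⟨1 + ∑ i, ∑ j, X i j ^ 2, by positivity, fun d _ => ?_⟩ ?_
    · have h1 := sum_mulVec_sq_le X d
      have h2 : 0 ≤ ∑ j, d j ^ 2 := Finset.sum_nonneg fun _ _ => sq_nonneg _
      have h3 : 0 ≤ ∑ i, X.mulVec d i ^ 2 := Finset.sum_nonneg fun _ _ => sq_nonneg _
      constructor <;> nlinarith [mul_nonneg hF h2]
    · rintro δ ⟨-, h⟩
      have := (le_div_iff₀ hpos).2 (h c hc).1
      linarith
  rw [← le_div_iff₀ hpos]
  linarith

theorem ripTheta_nonneg {n p : ℕ} (X : Matrix (Fin n) (Fin p) ℝ) (S S' : ℕ) :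
    0 ≤ ripTheta X S S' :=
  Real.sInf_nonneg fun _ h => h.1

theorem abs_sum_mulVec_le_ripTheta {n p : ℕ} (X : Matrix (Fin n) (Fin p) ℝ) (S S' : ℕ)
    {c c' : Fin p → ℝ} (hc : SSparse S c) (hc' : SSparse S' c')
    (hdisj : ∀ j, c j = 0 ∨ c' j = 0) :
    |∑ i, X.mulVec c i * X.mulVec c' i| ≤ ripTheta X S S' * l2norm c * l2norm c' := by
  have hF : 0 ≤ ∑ i, ∑ j, X i j ^ 2 :=
    Finset.sum_nonneg fun _ _ => Finset.sum_nonneg fun _ _ => sq_nonneg _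
  have hbound : ∀ d d' : Fin p → ℝ, |∑ i, X.mulVec d i * X.mulVec d' i| ≤
      (∑ i, ∑ j, X i j ^ 2) * l2norm d * l2norm d' := by
    intro d d'
    apply abs_le_of_sq_le_sq _
      (mul_nonneg (mul_nonneg hF (l2norm_nonneg d)) (l2norm_nonneg d'))
    calc (∑ i, X.mulVec d i * X.mulVec d' i) ^ 2
        ≤ (∑ i, X.mulVec d i ^ 2) * ∑ i, X.mulVec d' i ^ 2 :=
          Finset.sum_mul_sq_le_sq_mul_sq _ _ _
      _ ≤ ((∑ i, ∑ j, X i j ^ 2) * ∑ j, d j ^ 2) * ((∑ i, ∑ j, X i j ^ 2) * ∑ j, d' j ^ 2) := by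
          gcongr
          · exact sum_mulVec_sq_le X d
          · exact sum_mulVec_sq_le X d'
      _ = _ := by rw [← l2norm_sq, ← l2norm_sq]; ring
  rcases (mul_nonneg (l2norm_nonneg c) (l2norm_nonneg c')).eq_or_lt with h0 | hpos
  · have := hbound c c'
    rw [mul_assoc, ← h0, mul_zero] at this ⊢
    exact this
  rw [mul_assoc, ← div_le_iff₀ hpos]
  refine le_csInf ⟨_, hF, fun d d' _ _ _ => hbound d d'⟩ ?_
  rintro θ ⟨-, h⟩
  rw [div_le_iff₀ hpos, ← mul_assoc]
  exact h c c' hc hc' hdisj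

/-- The vector agreeing with `h` on `A` and vanishing elsewhere. -/
def restrictTo {p : ℕ} (A : Finset (Fin p)) (h : Fin p → ℝ) : Fin p → ℝ :=
  fun j => if j ∈ A then h j else 0

theorem sSparse_restrictTo {p S : ℕ} {A : Finset (Fin p)} (hA : A.card ≤ S) (h : Fin p → ℝ) :
    SSparse S (restrictTo A h) := by
  refine (Finset.card_le_card fun j hj => ?_).trans hA
  by_contra hjA
  simp [restrictTo, hjA] at hj

theorem l2norm_restrictTo_sq {p : ℕ} (A : Finset (Fin p)) (h : Fin p → ℝ) :
    l2norm (restrictTo A h) ^ 2 = ∑ j ∈ A, h j ^ 2 := by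
  simp [l2norm_sq, restrictTo, ite_pow]

theorem l2norm_restrictTo_le {p S : ℕ} {A : Finset (Fin p)} (hA : A.card ≤ S) {h : Fin p → ℝ}
    {M : ℝ} (hM : 0 ≤ M) (hAM : ∀ j ∈ A, |h j| ≤ M) :
    l2norm (restrictTo A h) ≤ Real.sqrt S * M := by
  apply le_of_sq_le_sq _ (by positivity)
  rw [l2norm_restrictTo_sq, mul_pow, Real.sq_sqrt (Nat.cast_nonneg S)]
  calc ∑ j ∈ A, h j ^ 2 ≤ A.card • M ^ 2 :=
        Finset.sum_le_card_nsmul _ _ _ fun j hj => sq_le_sq.2 ((hAM j hj).trans (le_abs_self M))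
    _ ≤ S * M ^ 2 := by
        rw [nsmul_eq_mul]
        gcongr

theorem sum_abs_le_sqrt_card_mul {p S : ℕ} {A : Finset (Fin p)} (hA : A.card ≤ S)
    (h : Fin p → ℝ) :
    ∑ j ∈ A, |h j| ≤ Real.sqrt S * l2norm (restrictTo A h) := by
  apply le_of_sq_le_sq _ (mul_nonneg (Real.sqrt_nonneg _) (l2norm_nonneg _))
  rw [mul_pow, l2norm_restrictTo_sq, Real.sq_sqrt (Nat.cast_nonneg S)]
  calc (∑ j ∈ A, |h j|) ^ 2 ≤ A.card * ∑ j ∈ A, |h j| ^ 2 := sq_sum_le_card_mul_sum_sq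
    _ ≤ S * ∑ j ∈ A, h j ^ 2 := by
        simp only [sq_abs]
        gcongr

theorem exists_subset_card_eq_of_largest {p : ℕ} (h : Fin p → ℝ) (A : Finset (Fin p)) (k : ℕ)
    (hk : k ≤ A.card) :
    ∃ B ⊆ A, B.card = k ∧ ∀ i ∈ B, ∀ j ∈ A \ B, |h j| ≤ |h i| := by
  induction k with
  | zero => exact ⟨∅, by simp⟩
  | succ k ih =>
    obtain ⟨B, hBA, hBk, hB⟩ := ih (by omega)
    have hne : (A \ B).Nonempty := by
      rw [← Finset.card_pos, Finset.card_sdiff_of_subset hBA]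
      omega
    obtain ⟨x, hx, hmax⟩ := Finset.exists_max_image (A \ B) (fun j => |h j|) hne
    rw [Finset.mem_sdiff] at hx
    refine ⟨insert x B, Finset.insert_subset hx.1 hBA, by
      rw [Finset.card_insert_of_notMem hx.2, hBk], fun i hi j hj => ?_⟩
    have hj' : j ∈ A \ B := Finset.sdiff_subset_sdiff le_rfl (Finset.subset_insert x B) hj
    rcases Finset.mem_insert.1 hi with rfl | hi
    · exact hmax j hj'
    · exact hB i hi j hj'

/-- The `S` largest entries on `A` (or all of them), with a threshold `m` separating them from
the remaining ones. -/
theorem exists_largest_block {p S : ℕ} (hS : 0 < S) (h : Fin p → ℝ) (A : Finset (Fin p)) :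
    ∃ B ⊆ A, ∃ m : ℝ, B.card ≤ S ∧ (A.Nonempty → B.Nonempty) ∧ 0 ≤ m ∧
      (∀ j ∈ A \ B, |h j| ≤ m) ∧ S * m ≤ ∑ j ∈ B, |h j| := by
  rcases le_total A.card S with hA | hA
  · refine ⟨A, le_rfl, 0, hA, id, le_rfl, by simp, ?_⟩
    rw [mul_zero]
    exact Finset.sum_nonneg fun _ _ => abs_nonneg _
  · obtain ⟨B, hBA, hBS, hB⟩ := exists_subset_card_eq_of_largest h A S hA
    have hne : B.Nonempty := by rw [← Finset.card_pos]; omega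
    obtain ⟨x, hx, hmin⟩ := Finset.exists_min_image B (fun j => |h j|) hne
    refine ⟨B, hBA, |h x|, hBS.le, fun _ => hne, abs_nonneg _, hB x hx, ?_⟩
    rw [← hBS, ← nsmul_eq_mul]
    exact Finset.card_nsmul_le_sum _ _ _ hmin

theorem sum_mulVec_add_mul {n p : ℕ} (X : Matrix (Fin n) (Fin p) ℝ) (a b v : Fin p → ℝ) :
    ∑ i, X.mulVec (a + b) i * X.mulVec v i =
      ∑ i, X.mulVec a i * X.mulVec v i + ∑ i, X.mulVec b i * X.mulVec v i := by
  simp [Matrix.mulVec_add, add_mul, Finset.sum_add_distrib]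

theorem restrictTo_add_restrictTo_sdiff {p : ℕ} {A B : Finset (Fin p)} (hBA : B ⊆ A)
    (h : Fin p → ℝ) : restrictTo A h = restrictTo B h + restrictTo (A \ B) h := by
  ext j
  by_cases hB : j ∈ B
  · simp [restrictTo, hB, hBA hB]
  · simp [restrictTo, hB]

/-- Splitting a vector into blocks of decreasing magnitude bounds its correlation with a
sparse vector of disjoint support. -/
theorem abs_sum_mulVec_restrictTo_le {n p S S' : ℕ} (hS : 0 < S)
    (X : Matrix (Fin n) (Fin p) ℝ) (h : Fin p → ℝ) {v : Fin p → ℝ} (hv : SSparse S' v)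
    (A : Finset (Fin p)) (hvA : ∀ j ∈ A, v j = 0) {M : ℝ} (hM : 0 ≤ M)
    (hAM : ∀ j ∈ A, |h j| ≤ M) :
    |∑ i, X.mulVec (restrictTo A h) i * X.mulVec v i| ≤
      ripTheta X S S' * l2norm v * (Real.sqrt S * M + (∑ j ∈ A, |h j|) / Real.sqrt S) := by
  induction A using Finset.strongInduction generalizing M with
  | H A ih =>
    have hθv : 0 ≤ ripTheta X S S' * l2norm v :=
      mul_nonneg (ripTheta_nonneg X S S') (l2norm_nonneg v)
    have hsqrt : 0 < Real.sqrt S := Real.sqrt_pos.2 (Nat.cast_pos.2 hS)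
    rcases A.eq_empty_or_nonempty with rfl | hne
    · have : restrictTo ∅ h = 0 := by ext j; simp [restrictTo]
      simp only [this, Matrix.mulVec_zero, Pi.zero_apply, zero_mul, Finset.sum_const_zero,
        abs_zero, Finset.sum_empty, zero_div, add_zero]
      positivity
    obtain ⟨B, hBA, m, hBS, hBne, hm, hle, hsum⟩ := exists_largest_block hS h A
    have hrest := ih (A \ B) (Finset.sdiff_ssubset hBA (hBne hne))
      (fun j hj => hvA j (Finset.sdiff_subset hj)) hm hle
    have hB : |∑ i, X.mulVec (restrictTo B h) i * X.mulVec v i| ≤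
        ripTheta X S S' * l2norm v * (Real.sqrt S * M) := by
      refine (abs_sum_mulVec_le_ripTheta X S S' (sSparse_restrictTo hBS h) hv fun j => ?_).trans ?_
      · by_cases hj : j ∈ B
        · exact Or.inr (hvA j (hBA hj))
        · exact Or.inl (by simp [restrictTo, hj])
      · rw [mul_right_comm]
        gcongr
        exact l2norm_restrictTo_le hBS hM fun j hj => hAM j (hBA hj)
    rw [restrictTo_add_restrictTo_sdiff hBA, sum_mulVec_add_mul]
    have hm' : Real.sqrt S * m ≤ (∑ j ∈ B, |h j|) / Real.sqrt S := by
      rw [le_div_iff₀ hsqrt, mul_right_comm, Real.mul_self_sqrt (Nat.cast_nonneg S)]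
      exact hsum
    calc _ ≤ _ := (abs_add_le _ _).trans (add_le_add hB hrest)
      _ ≤ ripTheta X S S' * l2norm v * (Real.sqrt S * M) + ripTheta X S S' * l2norm v *
          ((∑ j ∈ B, |h j|) / Real.sqrt S + (∑ j ∈ A \ B, |h j|) / Real.sqrt S) := by
        gcongr
      _ = _ := by
        rw [← Finset.sum_sdiff hBA]
        ring

/-- If `b` has no larger `ℓ¹` norm than `c`, then `b - c` has at most as much `ℓ¹` mass off the
support of `c` as on it. -/
theorem sum_abs_sub_compl_support_le {p : ℕ} {b c : Fin p → ℝ} (hbc : ∑ j, |b j| ≤ ∑ j, |c j|) :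
    ∑ j ∈ (Finset.univ.filter fun j => c j ≠ 0)ᶜ, |(b - c) j| ≤
      ∑ j ∈ Finset.univ.filter fun j => c j ≠ 0, |(b - c) j| := by
  set T := Finset.univ.filter fun j => c j ≠ 0
  rw [← Finset.sum_add_sum_compl T, ← Finset.sum_add_sum_compl T fun j => |c j|] at hbc
  have hc : ∀ j ∈ Tᶜ, c j = 0 := fun j hj => by simpa [T] using hj
  have h1 : ∑ j ∈ Tᶜ, |c j| = 0 := Finset.sum_eq_zero fun j hj => by rw [hc j hj, abs_zero]
  have h2 : ∑ j ∈ Tᶜ, |(b - c) j| = ∑ j ∈ Tᶜ, |b j| :=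
    Finset.sum_congr rfl fun j hj => by rw [Pi.sub_apply, hc j hj, sub_zero]
  have h3 : ∑ j ∈ T, |c j| ≤ ∑ j ∈ T, |b j| + ∑ j ∈ T, |(b - c) j| := by
    rw [← Finset.sum_add_distrib]
    refine Finset.sum_le_sum fun j _ => ?_
    have := abs_sub_abs_le_abs_sub (c j) (b j)
    rw [abs_sub_comm] at this
    simp only [Pi.sub_apply]
    linarith
  linarith

theorem sum_mulVec_mul_eq {n p : ℕ} (X : Matrix (Fin n) (Fin p) ℝ) (u : Fin p → ℝ)
    (y : Fin n → ℝ) : ∑ i, X.mulVec u i * y i = ∑ j, u j * ∑ i, X i j * y i := by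
  simp only [Matrix.mulVec, dotProduct, Finset.sum_mul, Finset.mul_sum]
  rw [Finset.sum_comm]
  exact Finset.sum_congr rfl fun _ _ => Finset.sum_congr rfl fun _ _ => by ring

/-- Deterministic error bound for a vector `h` in the cone of a set `T` of size at most `S` whose
correlations with the columns of `X` are uniformly bounded. -/
theorem l2norm_le_of_cone {n p S : ℕ} (X : Matrix (Fin n) (Fin p) ℝ)
    (hrip : ripDelta X (2 * S) + ripTheta X S (2 * S) < 1) {h : Fin p → ℝ} {T : Finset (Fin p)}
    (hT : T.card ≤ S) (hcone : ∑ j ∈ Tᶜ, |h j| ≤ ∑ j ∈ T, |h j|) {μ : ℝ} (hμ : 0 ≤ μ)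
    (hcorr : ∀ j, |∑ i, X i j * X.mulVec h i| ≤ μ) :
    l2norm h ≤ 2 * μ * Real.sqrt S / (1 - ripDelta X (2 * S) - ripTheta X S (2 * S)) := by
  have hden : 0 < 1 - ripDelta X (2 * S) - ripTheta X S (2 * S) := by linarith
  rcases Nat.eq_zero_or_pos S with rfl | hS
  · obtain rfl : T = ∅ := Finset.card_eq_zero.1 (Nat.le_zero.1 hT)
    rw [Finset.compl_empty, Finset.sum_empty] at hcone
    have hz := (Finset.sum_eq_zero_iff_of_nonneg fun j _ => abs_nonneg (h j)).1
      (le_antisymm hcone (Finset.sum_nonneg fun j _ => abs_nonneg (h j)))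
    have : h = 0 := funext fun j => abs_eq_zero.1 (hz j (Finset.mem_univ j))
    simp [this, l2norm]
  have hsqrt : 0 < Real.sqrt S := Real.sqrt_pos.2 (Nat.cast_pos.2 hS)
  have hS' : (0 : ℝ) < S := Nat.cast_pos.2 hS
  obtain ⟨B, hBT, m, hBS, -, hm, hle, hsum⟩ := exists_largest_block hS h Tᶜ
  have hcompl : (T ∪ B)ᶜ = Tᶜ \ B := by ext j; simp
  have hcard : (T ∪ B).card ≤ 2 * S := (Finset.card_union_le _ _).trans (by omega)
  set u := restrictTo (T ∪ B) h with hu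
  set r := ∑ j ∈ Tᶜ \ B, |h j| with hr
  have hr0 : 0 ≤ r := Finset.sum_nonneg fun _ _ => abs_nonneg _
  have hsplit : r + ∑ j ∈ B, |h j| = ∑ j ∈ Tᶜ, |h j| := Finset.sum_sdiff hBT
  have hTu : ∑ j ∈ T, |h j| ≤ Real.sqrt S * l2norm u := by
    refine (sum_abs_le_sqrt_card_mul hT h).trans ?_
    gcongr
    apply le_of_sq_le_sq _ (l2norm_nonneg u)
    rw [hu, l2norm_restrictTo_sq, l2norm_restrictTo_sq]
    exact Finset.sum_le_sum_of_subset_of_nonneg Finset.subset_union_left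
      fun _ _ _ => sq_nonneg _
  have hdecomp : h = u + restrictTo (Tᶜ \ B) h := by
    have := restrictTo_add_restrictTo_sdiff (Finset.subset_univ (T ∪ B)) h
    rw [← Finset.compl_eq_univ_sdiff, hcompl] at this
    rw [← this]
    ext j
    simp [restrictTo]
  have husparse : SSparse (2 * S) u := sSparse_restrictTo hcard h
  have htail : |∑ i, X.mulVec (restrictTo (Tᶜ \ B) h) i * X.mulVec u i| ≤
      ripTheta X S (2 * S) * l2norm u * l2norm u := by
    refine (abs_sum_mulVec_restrictTo_le hS X h husparse (Tᶜ \ B) (fun j hj => ?_) hm hle).trans ?_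
    · rw [← hcompl, Finset.mem_compl] at hj
      simp [hu, restrictTo, hj]
    · refine mul_le_mul_of_nonneg_left ?_
        (mul_nonneg (ripTheta_nonneg X S (2 * S)) (l2norm_nonneg u))
      rw [← mul_le_mul_iff_right₀ hsqrt, mul_add, mul_div_cancel₀ _ hsqrt.ne', ← mul_assoc,
        Real.mul_self_sqrt hS'.le]
      linarith
  have hhead : ∑ i, X.mulVec u i * X.mulVec h i ≤
      μ * (Real.sqrt 2 * Real.sqrt S * l2norm u) := by
    have hl1 : ∑ j, |u j| = ∑ j ∈ T ∪ B, |h j| := by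
      simp only [hu, restrictTo, apply_ite abs, abs_zero]
      rw [← Finset.sum_filter, Finset.filter_mem_eq_inter, Finset.univ_inter]
    have h1 := sum_abs_le_sqrt_card_mul hcard h
    rw [Nat.cast_mul, Nat.cast_ofNat, Real.sqrt_mul zero_le_two, ← hl1] at h1
    rw [sum_mulVec_mul_eq]
    calc ∑ j, u j * ∑ i, X i j * X.mulVec h i ≤ ∑ j, μ * |u j| := by
          refine Finset.sum_le_sum fun j _ => (le_abs_self _).trans ?_
          rw [abs_mul, mul_comm]
          exact mul_le_mul_of_nonneg_right (hcorr j) (abs_nonneg _)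
      _ = μ * ∑ j, |u j| := by rw [Finset.mul_sum]
      _ ≤ _ := mul_le_mul_of_nonneg_left h1 hμ
  have hub : (1 - ripDelta X (2 * S) - ripTheta X S (2 * S)) * l2norm u ≤
      μ * (Real.sqrt 2 * Real.sqrt S) := by
    have hlow := ripDelta_lower X (2 * S) husparse
    rw [← l2norm_sq] at hlow
    have hexp : ∑ i, X.mulVec u i * X.mulVec h i = ∑ i, X.mulVec u i ^ 2 +
        ∑ i, X.mulVec (restrictTo (Tᶜ \ B) h) i * X.mulVec u i := by
      simp_rw [mul_comm (X.mulVec u _) (X.mulVec h _), pow_two]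
      rw [← sum_mulVec_add_mul, ← hdecomp]
    rcases (l2norm_nonneg u).eq_or_lt with h0 | hpos
    · rw [← h0, mul_zero]
      positivity
    · refine le_of_mul_le_mul_right ?_ hpos
      nlinarith [(abs_le.1 htail).1]
  have hsq : l2norm h ^ 2 ≤ 2 * l2norm u ^ 2 := by
    have htail2 : ∑ j ∈ Tᶜ \ B, h j ^ 2 ≤ m * r := by
      rw [hr, Finset.mul_sum]
      refine Finset.sum_le_sum fun j hj => ?_
      rw [← sq_abs, pow_two]
      exact mul_le_mul_of_nonneg_right (hle j hj) (abs_nonneg _)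
    have hmr : m * r ≤ l2norm u ^ 2 := by
      have h1 : S * m + r ≤ Real.sqrt S * l2norm u := by linarith
      have h2 : (S * m + r) ^ 2 ≤ S * l2norm u ^ 2 := by
        calc _ ≤ (Real.sqrt S * l2norm u) ^ 2 := by gcongr
          _ = _ := by rw [mul_pow, Real.sq_sqrt hS'.le]
      refine le_of_mul_le_mul_left ?_ hS'
      nlinarith [mul_nonneg (mul_nonneg hS'.le hm) hr0, sq_nonneg (S * m), sq_nonneg r]
    rw [l2norm_sq, ← Finset.sum_add_sum_compl (T ∪ B), hcompl, ← l2norm_restrictTo_sq, ← hu]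
    linarith
  have hfin : l2norm h ≤ Real.sqrt 2 * l2norm u := by
    apply le_of_sq_le_sq _ (mul_nonneg (Real.sqrt_nonneg _) (l2norm_nonneg u))
    rwa [mul_pow, Real.sq_sqrt zero_le_two]
  rw [le_div_iff₀ hden]
  calc l2norm h * (1 - ripDelta X (2 * S) - ripTheta X S (2 * S))
      ≤ Real.sqrt 2 * l2norm u * (1 - ripDelta X (2 * S) - ripTheta X S (2 * S)) := by gcongr
    _ = Real.sqrt 2 * ((1 - ripDelta X (2 * S) - ripTheta X S (2 * S)) * l2norm u) := by ring
    _ ≤ Real.sqrt 2 * (μ * (Real.sqrt 2 * Real.sqrt S)) := by gcongr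
    _ = Real.sqrt 2 * Real.sqrt 2 * μ * Real.sqrt S := by ring
    _ = 2 * μ * Real.sqrt S := by rw [Real.mul_self_sqrt zero_le_two]

/-- **Lemma 1 of the paper (the Candès–Tao Dantzig selector error bound).**
If `Y = X̃γ̃ + ε` with `X̃` having unit ℓ²-norm columns, `γ̃` `S`-sparse,
`δ_{2S} + θ_{S,2S} < 1`, `‖X̃ᵀε‖_∞ ≤ λ`, and `γ̂` is a Dantzig selector solution for
`(Y, X̃, λ)`, then `‖γ̂ - γ̃‖₂ ≤ 4λ√S / (1 - δ_{2S} - θ_{S,2S})`. -/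
theorem flirti_lemma1 {n p S : ℕ}
    (Xt : Matrix (Fin n) (Fin p) ℝ) (hunit : ∀ j, ∑ i, (Xt i j) ^ 2 = 1)
    (γ : Fin p → ℝ) (hsparse : SSparse S γ)
    (hrip : ripDelta Xt (2 * S) + ripTheta Xt S (2 * S) < 1)
    (ε : Fin n → ℝ) (Y : Fin n → ℝ) (hY : Y = Xt.mulVec γ + ε)
    (lam : ℝ) (hlam : 0 ≤ lam) (hfeas : ∀ j, |∑ i, Xt i j * ε i| ≤ lam)
    (γhat : Fin p → ℝ) (hDS : IsDantzigSol Y Xt lam γhat) :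
    l2norm (γhat - γ) ≤
      4 * lam * Real.sqrt S / (1 - ripDelta Xt (2 * S) - ripTheta Xt S (2 * S)) := by
  have hγ : ∀ j, |∑ i, Xt i j * (Y i - Xt.mulVec γ i)| ≤ lam := by
    simpa [hY] using hfeas
  have hcorr : ∀ j, |∑ i, Xt i j * Xt.mulVec (γhat - γ) i| ≤ 2 * lam := by
    intro j
    have heq : ∑ i, Xt i j * Xt.mulVec (γhat - γ) i =
        ∑ i, Xt i j * (Y i - Xt.mulVec γ i) - ∑ i, Xt i j * (Y i - Xt.mulVec γhat i) := by
      rw [← Finset.sum_sub_distrib, Matrix.mulVec_sub]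
      exact Finset.sum_congr rfl fun i _ => by rw [Pi.sub_apply]; ring
    rw [heq]
    refine (abs_sub _ _).trans ?_
    linarith [hγ j, hDS.1 j]
  have := l2norm_le_of_cone Xt hrip hsparse
    (sum_abs_sub_compl_support_le (hDS.2 γ hγ)) (by positivity) hcorr
  rwa [← mul_assoc, show (2 : ℝ) * 2 = 4 by norm_num] at this
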